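/- Let X be a real-valued random variable with continuous distribution function F(·;X), and let Y be a square-integrable real-valued random variable on the same probability space. Then Var(E[Y | σ(X)]) = ∑_{j≥1} |LP(j,0;X,Y)|², where LP(j,0;X,Y) = E[Y · Leg_j(F(X;X))]. -/

import Mathlib

open MeasureTheory Set

/-- The `j`-th orthonormal shifted Legendre polynomial on `[0,1]`, i.e. the result of
Gram–Schmidt orthonormalization of the monomials `1, u, u², …` in
`L²([0,1])` (Rodrigues' formula): `Leg j u = √(2j+1)/j! · dʲ/duʲ (u²−u)ʲ`.
In particular `Leg 0 = 1` and `Leg 1 u = √12 (u − 1/2)`. -/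
noncomputable def Leg (j : ℕ) (u : ℝ) : ℝ :=
  (Real.sqrt (2 * j + 1) / j.factorial) * iteratedDeriv j (fun x => (x ^ 2 - x) ^ j) u

/-- The distribution function `F(x;X) = P(X ≤ x)`. -/
noncomputable def distFun {Ω : Type*} [MeasurableSpace Ω] (P : Measure Ω)
    (X : Ω → ℝ) (x : ℝ) : ℝ :=
  (P (X ⁻¹' Iic x)).toReal

open Polynomial in
/-- The polynomial underlying the function `Leg j`. -/
noncomputable def legPoly (j : ℕ) : ℝ[X] :=
  C (Real.sqrt (2 * j + 1) / j.factorial) * derivative^[j] ((X ^ 2 - X) ^ j)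

section LegendrePolynomials

open Polynomial

lemma Leg_eq_eval_legPoly (j : ℕ) (u : ℝ) : Leg j u = (legPoly j).eval u := by
  have h : ∀ (n : ℕ) (p : ℝ[X]),
      deriv^[n] (fun x => p.eval x) = fun x => (derivative^[n] p).eval x := by
    intro n
    induction n with
    | zero => intro p; rfl
    | succ n ih =>
      intro p
      rw [Function.iterate_succ_apply, Function.iterate_succ_apply, ← ih]
      congr 1
      ext x
      exact p.deriv
  have hfun : (fun x : ℝ => (x ^ 2 - x) ^ j) = fun x => (((X : ℝ[X]) ^ 2 - X) ^ j).eval x := by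
    ext x; simp
  rw [Leg, legPoly, iteratedDeriv_eq_iterate, hfun, h, eval_mul, eval_C]

lemma monic_X_sq_sub_X_pow (j : ℕ) : (((X : ℝ[X]) ^ 2 - X) ^ j).Monic := by
  apply Monic.pow
  monicity!

lemma natDegree_X_sq_sub_X_pow (j : ℕ) : (((X : ℝ[X]) ^ 2 - X) ^ j).natDegree = j + j := by
  rw [natDegree_pow]
  have : ((X : ℝ[X]) ^ 2 - X).natDegree = 2 := by compute_degree!
  rw [this]; ring

lemma degree_legPoly (j : ℕ) : (legPoly j).degree = j := by
  have hc : Real.sqrt (2 * j + 1) / j.factorial ≠ 0 := by positivity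
  rw [legPoly, degree_C_mul hc]
  apply le_antisymm
  · rw [← natDegree_le_iff_degree_le]
    refine (natDegree_iterate_derivative _ _).trans ?_
    rw [natDegree_X_sq_sub_X_pow]; omega
  · apply le_degree_of_ne_zero
    rw [coeff_iterate_derivative, ← natDegree_X_sq_sub_X_pow,
      (monic_X_sq_sub_X_pow j).coeff_natDegree, natDegree_X_sq_sub_X_pow]
    simp [Nat.descFactorial_eq_zero_iff_lt]

lemma span_range_legPoly : Submodule.span ℝ (range legPoly) = ⊤ :=
  Sequence.span ⟨legPoly, degree_legPoly⟩ fun i =>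
    (leadingCoeff_ne_zero.2 (Sequence.ne_zero ⟨legPoly, degree_legPoly⟩ i)).isUnit

lemma integral_derivative_mul_of_eval_eq_zero (p q : ℝ[X]) (h0 : p.eval 0 = 0)
    (h1 : p.eval 1 = 0) :
    ∫ x in (0 : ℝ)..1, p.derivative.eval x * q.eval x
      = -∫ x in (0 : ℝ)..1, p.eval x * q.derivative.eval x := by
  have := intervalIntegral.integral_mul_deriv_eq_deriv_mul (a := 0) (b := 1)
    (fun x _ => p.hasDerivAt x) (fun x _ => q.hasDerivAt x)
    (p.derivative.continuous.intervalIntegrable _ _)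
    (q.derivative.continuous.intervalIntegrable _ _)
  rw [this, h0, h1]; ring

lemma integral_iterate_derivative_mul (j k : ℕ) (hk : k ≤ j) (q : ℝ[X]) :
    ∫ x in (0 : ℝ)..1, (derivative^[k] ((X ^ 2 - X) ^ j)).eval x * q.eval x
      = (-1) ^ k * ∫ x in (0 : ℝ)..1, (((X : ℝ[X]) ^ 2 - X) ^ j).eval x
          * (derivative^[k] q).eval x := by
  induction k generalizing q with
  | zero => simp
  | succ k ih =>
    have hdvd := pow_sub_dvd_iterate_derivative_pow ((X : ℝ[X]) ^ 2 - X) j k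
    have hne : j - k ≠ 0 := by omega
    have hzero : ∀ x : ℝ, x ^ 2 - x = 0 →
        (derivative^[k] (((X : ℝ[X]) ^ 2 - X) ^ j)).eval x = 0 := by
      intro x hx
      refine eval_eq_zero_of_dvd_of_eval_eq_zero hdvd ?_
      simp [hx, hne]
    rw [Function.iterate_succ_apply', integral_derivative_mul_of_eval_eq_zero _ _
      (hzero 0 (by norm_num)) (hzero 1 (by norm_num)), ih (by omega),
      ← Function.iterate_succ_apply]
    ring

lemma integral_pow_mul_one_sub_pow (a b : ℕ) :
    (∫ x in (0 : ℝ)..1, x ^ a * (1 - x) ^ b) * (a + b + 1).factorial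
      = a.factorial * b.factorial := by
  induction b generalizing a with
  | zero => simp [Nat.factorial_succ]; field_simp
  | succ b ih =>
    have key : (a + 1 : ℝ) * ∫ x in (0 : ℝ)..1, x ^ a * (1 - x) ^ (b + 1)
        = (b + 1) * ∫ x in (0 : ℝ)..1, x ^ (a + 1) * (1 - x) ^ b := by
      have hmem : ∀ x ∈ uIcc (0 : ℝ) 1, HasDerivAt (fun x : ℝ => x ^ (a + 1))
          ((a + 1) * x ^ a) x := fun x _ => by simpa using hasDerivAt_pow (a + 1) x
      have hmem' : ∀ x ∈ uIcc (0 : ℝ) 1, HasDerivAt (fun x : ℝ => (1 - x) ^ (b + 1))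
          (-((b + 1) * (1 - x) ^ b)) x := fun x _ => by
        simpa using ((hasDerivAt_id x).const_sub 1).fun_pow (b + 1)
      have := intervalIntegral.integral_mul_deriv_eq_deriv_mul hmem hmem'
        (Continuous.intervalIntegrable (by fun_prop) _ _)
        (Continuous.intervalIntegrable (by fun_prop) _ _)
      rw [← intervalIntegral.integral_const_mul, ← intervalIntegral.integral_const_mul]
      simp only [mul_neg, intervalIntegral.integral_neg] at this
      simp only [← mul_assoc, mul_comm _ (b + 1 : ℝ)] at this ⊢
      simp at this
      linarith
    have h := ih (a + 1)
    rw [show a + 1 + b + 1 = a + (b + 1) + 1 by ring] at h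
    have ha : (a + 1 : ℝ) ≠ 0 := by positivity
    apply mul_left_cancel₀ ha
    rw [← mul_assoc, key, mul_assoc, h, Nat.factorial_succ a, Nat.factorial_succ b]
    push_cast; ring

lemma integral_legPoly_mul_of_lt {i j : ℕ} (hij : i < j) :
    ∫ x in (0 : ℝ)..1, (legPoly j).eval x * (legPoly i).eval x = 0 := by
  simp only [legPoly.eq_1 j, eval_mul, eval_C, mul_assoc]
  rw [intervalIntegral.integral_const_mul, integral_iterate_derivative_mul j j le_rfl,
    iterate_derivative_eq_zero]
  · simp
  · rwa [natDegree_eq_of_degree_eq_some (degree_legPoly i)]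

lemma integral_legPoly_mul_self (j : ℕ) :
    ∫ x in (0 : ℝ)..1, (legPoly j).eval x * (legPoly j).eval x = 1 := by
  have hD : derivative^[j] (derivative^[j] (((X : ℝ[X]) ^ 2 - X) ^ j))
      = C ((j + j).factorial : ℝ) := by
    rw [← Function.iterate_add_apply]
    have h0 : (derivative^[j + j] (((X : ℝ[X]) ^ 2 - X) ^ j)).natDegree = 0 := by
      have := natDegree_iterate_derivative (((X : ℝ[X]) ^ 2 - X) ^ j) (j + j)
      rw [natDegree_X_sq_sub_X_pow] at this
      omega
    rw [eq_C_of_natDegree_eq_zero h0, coeff_iterate_derivative, zero_add]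
    nth_rewrite 3 [← natDegree_X_sq_sub_X_pow]
    rw [(monic_X_sq_sub_X_pow j).coeff_natDegree, Nat.descFactorial_self]
    simp
  have hbeta := integral_pow_mul_one_sub_pow j j
  have hsq : Real.sqrt (2 * j + 1) * Real.sqrt (2 * j + 1) = 2 * j + 1 :=
    Real.mul_self_sqrt (by positivity)
  have hInt : ∫ x in (0 : ℝ)..1, (((X : ℝ[X]) ^ 2 - X) ^ j).eval x
      = (-1) ^ j * ∫ x in (0 : ℝ)..1, x ^ j * (1 - x) ^ j := by
    rw [← intervalIntegral.integral_const_mul]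
    congr 1; ext x
    simp only [eval_pow, eval_sub, eval_X]
    rw [← mul_pow, ← mul_pow]; ring
  have hsgn : ((-1 : ℝ) ^ j) * (-1) ^ j = 1 := by rw [← mul_pow]; simp
  set c := Real.sqrt (2 * j + 1) / (j.factorial : ℝ) with hc
  have hcc : c * c * (j.factorial * j.factorial) = 2 * j + 1 := by
    rw [← hsq, hc]; field_simp
  simp only [legPoly, ← hc, eval_mul, eval_C]
  have : ∀ x : ℝ, c * (derivative^[j] (((X : ℝ[X]) ^ 2 - X) ^ j)).eval x
      * (c * (derivative^[j] (((X : ℝ[X]) ^ 2 - X) ^ j)).eval x)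
      = c * c * ((derivative^[j] (((X : ℝ[X]) ^ 2 - X) ^ j)).eval x
        * (derivative^[j] (((X : ℝ[X]) ^ 2 - X) ^ j)).eval x) := fun x => by ring
  simp only [this]
  rw [intervalIntegral.integral_const_mul, integral_iterate_derivative_mul j j le_rfl, hD]
  simp only [eval_C]
  rw [intervalIntegral.integral_mul_const, hInt]
  rw [Nat.factorial_succ] at hbeta
  push_cast at hbeta
  have hpos : (2 * j + 1 : ℝ) ≠ 0 := by positivity
  apply mul_left_cancel₀ hpos
  generalize (∫ x in (0 : ℝ)..1, x ^ j * (1 - x) ^ j) = I at *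
  calc _ = ((-1 : ℝ) ^ j * (-1) ^ j) * (c * c * (I * ((j + j + 1) * (j + j).factorial))) := by ring
    _ = 2 * j + 1 := by rw [hsgn, hbeta, hcc, one_mul]
    _ = _ := by ring

end LegendrePolynomials

section UniformTransform

open ProbabilityTheory Filter Topology

variable {μ : Measure ℝ} [IsProbabilityMeasure μ]

lemma preimage_cdf_Iic_ae_eq (hF : Continuous (cdf μ)) (a : ℝ) :
    cdf μ ⁻¹' Iic (cdf μ a) =ᵐ[μ] Iic a := by
  have hsub : Iic a ⊆ cdf μ ⁻¹' Iic (cdf μ a) := fun x hx => monotone_cdf μ hx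
  refine (ae_eq_of_subset_of_measure_ge hsub ?_ measurableSet_Iic.nullMeasurableSet
    (measure_ne_top _ _)).symm
  set S := cdf μ ⁻¹' Iic (cdf μ a) with hS
  have hcl : IsClosed S := isClosed_Iic.preimage hF
  rw [← ofReal_cdf]
  by_cases hb : BddAbove S
  · have hmem : sSup S ∈ S := hcl.csSup_mem ⟨a, hsub self_mem_Iic⟩ hb
    calc μ S ≤ μ (Iic (sSup S)) := measure_mono fun x hx => le_csSup hb hx
      _ = ENNReal.ofReal (cdf μ (sSup S)) := (ofReal_cdf μ _).symm
      _ ≤ ENNReal.ofReal (cdf μ a) := ENNReal.ofReal_le_ofReal hmem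
  · have hle : ∀ x, cdf μ x ≤ cdf μ a := fun x => by
      obtain ⟨y, hy, hxy⟩ := not_bddAbove_iff.1 hb x
      exact (monotone_cdf μ hxy.le).trans hy
    have h1 : 1 ≤ cdf μ a := le_of_tendsto' (tendsto_cdf_atTop μ) hle
    exact prob_le_one.trans (by simpa using h1)

lemma map_cdf_eq_volume_restrict (hF : Continuous (cdf μ)) :
    μ.map (cdf μ) = volume.restrict (Icc 0 1) := by
  have hfin : IsProbabilityMeasure (μ.map (cdf μ)) :=
    Measure.isProbabilityMeasure_map hF.aemeasurable
  have hIoo : ∀ t ∈ Ioo (0 : ℝ) 1, μ (cdf μ ⁻¹' Iic t) = ENNReal.ofReal t := by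
    intro t ht
    obtain ⟨a, rfl⟩ : t ∈ range (cdf μ) :=
      mem_range_of_exists_le_of_exists_ge hF
        (((tendsto_cdf_atBot μ).eventually (eventually_le_nhds ht.1)).exists)
        (((tendsto_cdf_atTop μ).eventually (eventually_ge_nhds ht.2)).exists)
    rw [measure_congr (preimage_cdf_Iic_ae_eq hF a), ofReal_cdf]
  refine Measure.ext_of_Iic _ _ fun t => ?_
  rw [Measure.map_apply hF.measurable measurableSet_Iic,
    Measure.restrict_apply measurableSet_Iic]
  rcases lt_or_ge t 1 with h1 | h1
  · have hset : Iic t ∩ Icc 0 1 = Icc 0 t := by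
      ext x; simp only [mem_inter_iff, mem_Iic, mem_Icc]
      exact ⟨fun h => ⟨h.2.1, h.1⟩, fun h => ⟨h.2, h.1, h.2.trans h1.le⟩⟩
    rw [hset, Real.volume_Icc, sub_zero]
    rcases lt_or_ge 0 t with h0 | h0
    · exact hIoo t ⟨h0, h1⟩
    · rw [ENNReal.ofReal_of_nonpos h0]
      refine le_antisymm (ENNReal.le_of_forall_pos_le_add fun ε hε _ => ?_) zero_le
      have hε' : 0 < min (ε : ℝ) (1 / 2) := lt_min (by exact_mod_cast hε) (by norm_num)
      calc μ (cdf μ ⁻¹' Iic t) ≤ μ (cdf μ ⁻¹' Iic (min (ε : ℝ) (1 / 2))) :=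
            measure_mono (preimage_mono (Iic_subset_Iic.2 (h0.trans hε'.le)))
        _ = ENNReal.ofReal (min (ε : ℝ) (1 / 2)) :=
            hIoo _ ⟨hε', (min_le_right _ _).trans_lt (by norm_num)⟩
        _ ≤ ENNReal.ofReal ε := ENNReal.ofReal_le_ofReal (min_le_left _ _)
        _ = 0 + ε := by simp
  · have huniv : cdf μ ⁻¹' Iic t = univ :=
      eq_univ_of_forall fun x => (cdf_le_one μ x).trans h1
    have hset : Iic t ∩ Icc 0 1 = Icc (0 : ℝ) 1 :=
      inter_eq_right.2 fun x hx => hx.2.trans h1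
    simp [huniv, hset]

lemma integral_comp_cdf (hF : Continuous (cdf μ)) {h : ℝ → ℝ} (hh : Continuous h) :
    ∫ x, h (cdf μ x) ∂μ = ∫ u in (0 : ℝ)..1, h u := by
  rw [← integral_map hF.aemeasurable hh.aestronglyMeasurable, map_cdf_eq_volume_restrict hF,
    intervalIntegral.integral_of_le zero_le_one, integral_Icc_eq_integral_Ioc]

end UniformTransform

section Completeness

open ProbabilityTheory Filter Topology Polynomial BoundedContinuousFunction

lemma exists_norm_comp_le {α : Type*} {T : α → ℝ} (hT : ∀ x, T x ∈ Icc (0 : ℝ) 1)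
    {h : ℝ → ℝ} (hh : Continuous h) : ∃ C, ∀ x, ‖h (T x)‖ ≤ C := by
  obtain ⟨C, hC⟩ := isCompact_Icc.exists_bound_of_continuousOn
    (s := Icc (0 : ℝ) 1) hh.continuousOn
  exact ⟨C, fun x => hC _ (hT x)⟩

variable {α : Type*} [MeasurableSpace α] {μ : Measure α} {f T : α → ℝ}

lemma integrable_mul_comp (hf : Integrable f μ) (hTm : Measurable T)
    (hT : ∀ x, T x ∈ Icc (0 : ℝ) 1) {h : ℝ → ℝ} (hh : Continuous h) :
    Integrable (fun x => f x * h (T x)) μ := by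
  obtain ⟨C, hC⟩ := exists_norm_comp_le hT hh
  exact hf.mul_bdd (hh.measurable.comp hTm).aestronglyMeasurable (ae_of_all _ hC)

lemma integral_mul_comp_eq_zero_of_polynomial (hf : Integrable f μ) (hTm : Measurable T)
    (hT : ∀ x, T x ∈ Icc (0 : ℝ) 1) (hp : ∀ p : ℝ[X], ∫ x, f x * p.eval (T x) ∂μ = 0)
    {h : ℝ → ℝ} (hh : Continuous h) : ∫ x, f x * h (T x) ∂μ = 0 := by
  rw [← abs_nonpos_iff]
  refine le_of_forall_pos_le_add fun ε hε => ?_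
  set M := ∫ x, ‖f x‖ ∂μ with hM
  have hM0 : 0 ≤ M := integral_nonneg fun _ => norm_nonneg _
  obtain ⟨p, hpε⟩ := exists_polynomial_near_of_continuousOn 0 1 h hh.continuousOn
    (ε / (M + 1)) (by positivity)
  have hsub : ∫ x, f x * h (T x) ∂μ = ∫ x, (f x * h (T x) - f x * p.eval (T x)) ∂μ := by
    rw [integral_sub (integrable_mul_comp hf hTm hT hh)
      (integrable_mul_comp hf hTm hT p.continuous), hp, sub_zero]
  rw [hsub, zero_add, ← Real.norm_eq_abs]
  calc ‖∫ x, (f x * h (T x) - f x * p.eval (T x)) ∂μ‖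
      ≤ ∫ x, ‖f x‖ * (ε / (M + 1)) ∂μ := by
        refine norm_integral_le_of_norm_le (hf.norm.mul_const _) (ae_of_all _ fun x => ?_)
        rw [← mul_sub, norm_mul, norm_sub_rev]
        exact mul_le_mul_of_nonneg_left (hpε _ (hT x)).le (norm_nonneg _)
    _ = M * (ε / (M + 1)) := by rw [integral_mul_const]
    _ ≤ ε := by
        rw [mul_div_assoc', div_le_iff₀ (by positivity)]
        nlinarith

lemma map_withDensity_ofReal_eq_of_polynomial (hf : Integrable f μ) (hTm : Measurable T)
    (hT : ∀ x, T x ∈ Icc (0 : ℝ) 1) (hp : ∀ p : ℝ[X], ∫ x, f x * p.eval (T x) ∂μ = 0) :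
    (μ.withDensity fun x => ENNReal.ofReal (f x)).map T
      = (μ.withDensity fun x => ENNReal.ofReal (-f x)).map T := by
  have := isFiniteMeasure_withDensity_ofReal hf.2
  have : IsFiniteMeasure (μ.withDensity fun x => ENNReal.ofReal (-f x)) :=
    isFiniteMeasure_withDensity_ofReal hf.neg.2
  refine ext_of_forall_integral_eq_of_IsFiniteMeasure fun h => ?_
  have key : ∀ g : α → ℝ, Integrable g μ →
      ∫ x, h x ∂(μ.withDensity fun x => ENNReal.ofReal (g x)).map T
        = ∫ x, max (g x) 0 * h (T x) ∂μ := by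
    intro g hg
    rw [integral_map hTm.aemeasurable h.continuous.aestronglyMeasurable,
      integral_withDensity_eq_integral_toReal_smul₀ hg.1.aemeasurable.ennreal_ofReal
        (ae_of_all _ fun _ => ENNReal.ofReal_lt_top)]
    simp [ENNReal.toReal_ofReal']
  rw [key f hf, key (fun x => -f x) hf.neg, ← sub_eq_zero,
    ← integral_sub (integrable_mul_comp hf.pos_part hTm hT h.continuous)
      (integrable_mul_comp hf.neg_part hTm hT h.continuous)]
  refine Eq.trans ?_ (integral_mul_comp_eq_zero_of_polynomial hf hTm hT hp h.continuous)
  refine integral_congr_ae (ae_of_all _ fun x => ?_)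
  simp only
  rw [← sub_mul, max_zero_sub_eq_self]

end Completeness

section Parseval

open ProbabilityTheory Filter Topology Polynomial

lemma cdf_mem_Icc (μ : Measure ℝ) (x : ℝ) : cdf μ x ∈ Icc (0 : ℝ) 1 :=
  ⟨cdf_nonneg μ x, cdf_le_one μ x⟩

variable {μ : Measure ℝ} [IsProbabilityMeasure μ]

lemma ae_eq_zero_of_integral_mul_polynomial_cdf (hF : Continuous (cdf μ)) {f : ℝ → ℝ}
    (hf : Integrable f μ) (hp : ∀ p : ℝ[X], ∫ x, f x * p.eval (cdf μ x) ∂μ = 0) :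
    f =ᵐ[μ] 0 := by
  have hmap := map_withDensity_ofReal_eq_of_polynomial hf hF.measurable (cdf_mem_Icc μ) hp
  have := isFiniteMeasure_withDensity_ofReal hf.2
  have : IsFiniteMeasure (μ.withDensity fun x => ENNReal.ofReal (-f x)) :=
    isFiniteMeasure_withDensity_ofReal hf.neg.2
  have heq : (μ.withDensity fun x => ENNReal.ofReal (f x))
      = μ.withDensity fun x => ENNReal.ofReal (-f x) := by
    refine Measure.ext_of_Iic _ _ fun a => ?_
    have hae := preimage_cdf_Iic_ae_eq hF a
    have happ := congrArg (fun m => m (Iic (cdf μ a))) hmap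
    simp only [Measure.map_apply hF.measurable measurableSet_Iic] at happ
    rwa [measure_congr ((withDensity_absolutelyContinuous μ _).ae_le hae),
      measure_congr ((withDensity_absolutelyContinuous μ _).ae_le hae)] at happ
  have hae := (withDensity_eq_iff_of_sigmaFinite hf.1.aemeasurable.ennreal_ofReal
    hf.1.aemeasurable.neg.ennreal_ofReal).1 heq
  filter_upwards [hae] with x hx
  rcases le_total (f x) 0 with h | h
  · have : -f x ≤ 0 := by
      rw [ENNReal.ofReal_of_nonpos h] at hx
      exact ENNReal.ofReal_eq_zero.1 hx.symm
    simp only [Pi.zero_apply]; linarith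
  · have : f x ≤ 0 := by
      rw [ENNReal.ofReal_of_nonpos (p := (-f) x) (by simpa using h)] at hx
      exact ENNReal.ofReal_eq_zero.1 hx
    exact le_antisymm this h

lemma memLp_eval_cdf (hF : Continuous (cdf μ)) (p : ℝ[X]) :
    MemLp (fun x => p.eval (cdf μ x)) 2 μ := by
  obtain ⟨C, hC⟩ := exists_norm_comp_le (T := cdf μ) (cdf_mem_Icc μ) p.continuous
  exact MemLp.of_bound (p.continuous.comp hF).aestronglyMeasurable C (ae_of_all _ hC)

lemma inner_toLp_eq_integral {α : Type*} [MeasurableSpace α] {ν : Measure α} {f g : α → ℝ}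
    (hf : MemLp f 2 ν) (hg : MemLp g 2 ν) :
    inner ℝ (hf.toLp f) (hg.toLp g) = ∫ x, f x * g x ∂ν := by
  rw [L2.inner_def]
  refine integral_congr_ae ?_
  filter_upwards [hf.coeFn_toLp, hg.coeFn_toLp] with x h1 h2
  rw [h1, h2, RCLike.inner_apply, conj_trivial, mul_comm]

lemma orthonormal_legPoly_cdf (hF : Continuous (cdf μ)) :
    Orthonormal ℝ fun j => (memLp_eval_cdf hF (legPoly j)).toLp := by
  rw [orthonormal_iff_ite]
  intro i j
  rw [inner_toLp_eq_integral, integral_comp_cdf hF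
    (h := fun u => (legPoly i).eval u * (legPoly j).eval u) (by fun_prop)]
  rcases lt_trichotomy i j with h | rfl | h
  · rw [if_neg h.ne]
    simpa only [mul_comm] using integral_legPoly_mul_of_lt h
  · rw [if_pos rfl, integral_legPoly_mul_self]
  · rw [if_neg h.ne', integral_legPoly_mul_of_lt h]

lemma orthogonal_span_legPoly_cdf (hF : Continuous (cdf μ)) :
    (Submodule.span ℝ (range fun j => (memLp_eval_cdf hF (legPoly j)).toLp))ᗮ = ⊥ := by
  rw [Submodule.eq_bot_iff]
  intro f hf
  have hfL := Lp.memLp f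
  rw [Lp.eq_zero_iff_ae_eq_zero]
  have hInt := hfL.integrable one_le_two
  refine ae_eq_zero_of_integral_mul_polynomial_cdf hF hInt fun p => ?_
  have hmem : p ∈ Submodule.span ℝ (range legPoly) := by
    rw [span_range_legPoly]; trivial
  induction hmem using Submodule.span_induction with
  | mem q hq =>
    obtain ⟨j, rfl⟩ := hq
    rw [← inner_toLp_eq_integral hfL (memLp_eval_cdf hF _), Lp.toLp_coeFn]
    exact Submodule.inner_left_of_mem_orthogonal (Submodule.subset_span (mem_range_self j)) hf
  | zero => simp
  | add p q _ _ hp hq =>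
    simp only [eval_add, mul_add]
    have hadd := integral_add (hfL.integrable_mul (memLp_eval_cdf hF p))
      (hfL.integrable_mul (memLp_eval_cdf hF q))
    simp only [Pi.mul_apply, hp, hq, add_zero] at hadd
    exact hadd
  | smul c p _ hp =>
    simp only [eval_smul, smul_eq_mul, mul_left_comm _ c]
    rw [integral_const_mul, hp, mul_zero]

lemma hasSum_sq_integral_mul_Leg_cdf (hF : Continuous (cdf μ)) {g : ℝ → ℝ}
    (hg : MemLp g 2 μ) :
    HasSum (fun j => (∫ x, g x * Leg j (cdf μ x) ∂μ) ^ 2) (∫ x, g x ^ 2 ∂μ) := by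
  have h := (HilbertBasis.mkOfOrthogonalEqBot (orthonormal_legPoly_cdf hF)
    (orthogonal_span_legPoly_cdf hF)).hasSum_inner_mul_inner (hg.toLp g) (hg.toLp g)
  simp only [HilbertBasis.coe_mkOfOrthogonalEqBot, inner_toLp_eq_integral] at h
  simp only [pow_two, Leg_eq_eval_legPoly]
  simpa only [mul_comm] using h

end Parseval

lemma distFun_eq_cdf {Ω : Type*} [MeasurableSpace Ω] (P : Measure Ω) [IsProbabilityMeasure P]
    {X : Ω → ℝ} (hX : Measurable X) : distFun P X = ProbabilityTheory.cdf (P.map X) := by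
  have := Measure.isProbabilityMeasure_map (μ := P) hX.aemeasurable
  ext x
  rw [ProbabilityTheory.cdf_eq_real, measureReal_def, Measure.map_apply hX measurableSet_Iic,
    distFun]

lemma Leg_zero (u : ℝ) : Leg 0 u = 1 := by simp [Leg]

lemma continuous_Leg (j : ℕ) : Continuous (Leg j) := by
  have : Leg j = fun u => (legPoly j).eval u := funext (Leg_eq_eval_legPoly j)
  rw [this]
  exact (legPoly j).continuous

/-- If `X` has a continuous distribution function and `Y` is
square integrable then `Var(E[Y|σ(X)]) = ∑_{j≥1} |LP(j,0;X,Y)|²` where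
`LP(j,0;X,Y) = E[Y · Leg_j(F(X;X))]`. -/
theorem variance_condexp_eq_sum_sq_LP {Ω : Type*} [MeasurableSpace Ω]
    (P : Measure Ω) [IsProbabilityMeasure P] (X : Ω → ℝ) (hX : Measurable X)
    (hF : Continuous (distFun P X)) (Y : Ω → ℝ) (hY : MemLp Y 2 P) :
    ProbabilityTheory.variance (P[Y | MeasurableSpace.comap X Real.measurableSpace]) P
      = ∑' j : ℕ, |∫ ω, Y ω * Leg (j + 1) (distFun P X (X ω)) ∂P| ^ 2 := by
  have hprob := Measure.isProbabilityMeasure_map (μ := P) hX.aemeasurable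
  have hm : MeasurableSpace.comap X Real.measurableSpace ≤ _ := hX.comap_le
  have hZ : MemLp (P[Y | MeasurableSpace.comap X Real.measurableSpace]) 2 P :=
    hY.condExp one_le_two
  obtain ⟨g, hg, hgZ⟩ := (stronglyMeasurable_condExp (μ := P) (f := Y)
    (m := MeasurableSpace.comap X Real.measurableSpace)).measurable.exists_eq_measurable_comp
  rw [distFun_eq_cdf P hX] at hF ⊢
  have hgL : MemLp g 2 (P.map X) := by
    rw [memLp_map_measure_iff hg.aestronglyMeasurable hX.aemeasurable, ← hgZ]
    exact hZ
  have hcoef : ∀ j, ∫ x, g x * Leg j (ProbabilityTheory.cdf (P.map X) x) ∂P.map X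
      = ∫ ω, Y ω * Leg j (ProbabilityTheory.cdf (P.map X) (X ω)) ∂P := by
    intro j
    have hc : Continuous fun x => Leg j (ProbabilityTheory.cdf (P.map X) x) :=
      (continuous_Leg j).comp hF
    have hInt := integrable_mul_comp (hY.integrable one_le_two) (hF.measurable.comp hX)
      (fun ω => cdf_mem_Icc _ (X ω)) (continuous_Leg j)
    have hcm := hc.measurable
    rw [integral_map hX.aemeasurable (hg.fun_mul hcm).aestronglyMeasurable,
      ← integral_condExp hm (f := fun ω => Y ω * _)]
    refine integral_congr_ae ?_
    have hpull := condExp_mul_of_stronglyMeasurable_right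
      (hc.measurable.comp (comap_measurable X)).stronglyMeasurable hInt
      (hY.integrable one_le_two)
    refine Filter.EventuallyEq.trans (ae_of_all _ fun ω => ?_) hpull.symm
    simp [hgZ]
  have hsum := hasSum_sq_integral_mul_Leg_cdf hF hgL
  simp only [hcoef] at hsum
  rw [← hasSum_nat_add_iff' 1] at hsum
  simp only [sq_abs]
  rw [hsum.tsum_eq, ProbabilityTheory.variance_eq_sub hZ, integral_condExp hm,
    integral_map hX.aemeasurable (hg.pow_const 2).aestronglyMeasurable]
  simp [hgZ, Leg_zero]
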